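/- Let a, d, k be positive integers with gcd(a,d)=1 and 2 ≤ k ≤ a, let a−1 = q(k−1)+r with 0 ≤ r < k−1, set a_k = a+(k−1)d, and define P(x) = 1 + x^{a+d}·(Σ_{j=0}^{k−2} x^{jd})·(Σ_{s=0}^{q−1} x^{s a_k}) + x^{q a_k + a + d}·(Σ_{t=0}^{r−1} x^{td}). Let λ ∈ ℂ with λ ≠ 0, λ^{a} ≠ 1 and λ^{d} ≠ 1, and let μ be a positive integer. Then s_μ^{(λ)}(a, a+d, …, a+(k−1)d) = Σ_{n=0}^{μ} ((−a)^n/(λ^{a}−1)^{n+1})·C(μ,n)·Σ_{j=0}^{n} ⟨n, n−j⟩ λ^{ja} · Σ_{i=0}^{μ−n} S(μ−n,i) λ^{i} P^{(i)}(λ) + ((−1)^{μ+1}/(λ−1)^{μ+1})·Σ_{j=0}^{μ} ⟨μ, μ−j⟩ λ^{j}, where P^{(i)} is the i-th derivative of P. -/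

import Mathlib

open Finset

/-- `n` is representable as a nonnegative integer combination of the `a i`. -/
def Representable {k : ℕ} (a : Fin k → ℕ) (n : ℕ) : Prop :=
  ∃ x : Fin k → ℕ, n = ∑ i, x i * a i

/-- The set of positive integers that are not representable. -/
def NRset {k : ℕ} (a : Fin k → ℕ) : Set ℕ :=
  {n | 0 < n ∧ ¬ Representable a n}

/-- Stirling numbers of the second kind, as complex numbers. -/
noncomputable def stirling2 (n m : ℕ) : ℂ :=
  (1 / (m.factorial : ℂ)) *
    ∑ i ∈ Finset.range (m + 1), (-1 : ℂ) ^ i * (m.choose i : ℂ) * ((m - i : ℕ) : ℂ) ^ n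

/-- Eulerian numbers `⟨n,m⟩ = Σ_{k=0}^{m} (−1)^k C(n+1,k)(m−k+1)^n`. -/
def eulerianNum (n m : ℕ) : ℤ :=
  ∑ k ∈ Finset.range (m + 1), (-1 : ℤ) ^ k * ((n + 1).choose k : ℤ) * ((m - k + 1 : ℕ) : ℤ) ^ n

/-- The `(n+1)`-st finite difference of `x ↦ x ^ n` vanishes. -/
theorem sum_neg_one_pow_mul_choose_mul_sub_pow (n : ℕ) (y : ℤ) :
    ∑ k ∈ range (n + 2), (-1 : ℤ) ^ k * ((n + 1).choose k : ℤ) * (y - k) ^ n = 0 := by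
  have h := congrFun (fwdDiff_iter_pow_eq_zero_of_lt (R := ℤ) (Nat.lt_succ_self n)) (y - (n + 1))
  rw [fwdDiff_iter_eq_sum_shift, ← sum_flip] at h
  rw [← Pi.zero_apply (M := fun _ : ℤ => ℤ), ← h]
  refine sum_congr rfl fun k hk => ?_
  have hk' : k ≤ n + 1 := by simpa [Nat.lt_succ_iff] using hk
  simp only [Nat.succ_eq_add_one, Nat.sub_sub_self hk', Nat.choose_symm hk', smul_eq_mul,
    nsmul_eq_mul, mul_one, Nat.cast_sub hk']
  push_cast
  ring_nf

theorem eulerianNum_sub_eq_sum {n j : ℕ} (hj : j ≤ n) :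
    eulerianNum n (n - j) =
      ∑ k ∈ range (j + 1), (-1 : ℤ) ^ k * ((n + 1).choose k : ℤ) * ((j : ℤ) - k) ^ n := by
  have h := sum_neg_one_pow_mul_choose_mul_sub_pow n j
  rw [show n + 2 = (j + 1) + (n - j + 1) by omega, sum_range_add,
    ← sum_flip fun x => (-1 : ℤ) ^ (j + 1 + x) * ((n + 1).choose (j + 1 + x) : ℤ) *
      ((j : ℤ) - (j + 1 + x : ℕ)) ^ n] at h
  rw [eulerianNum, eq_comm, ← sub_eq_zero, sub_eq_add_neg, ← h, ← sum_neg_distrib]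
  · congr 1
    refine sum_congr rfl fun k hk => ?_
    have hk' : k ≤ n - j := by simpa [Nat.lt_succ_iff] using hk
    have h1 : j + 1 + (n - j - k) = n + 1 - k := by omega
    rw [h1, Nat.choose_symm (by omega), Nat.cast_sub (by omega)]
    have h2 : ((j : ℤ) - ((n + 1 : ℕ) - k)) = (-1) * ((n - j - k + 1 : ℕ) : ℤ) := by
      push_cast [Nat.cast_sub hk', Nat.cast_sub hj]; ring
    rw [h2, mul_pow]
    have h3 : (-1 : ℤ) ^ (n + 1 - k) * (-1) ^ n = - (-1) ^ k := by
      rw [← pow_add, show n + 1 - k + n = 2 * (n - k) + 1 + k by omega, pow_add, pow_add, pow_mul]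
      simp
    linear_combination (-((n + 1).choose k : ℤ) * ((n - j - k + 1 : ℕ) : ℤ) ^ n) * h3

/-- The polynomial `∑ j ≤ n, ⟨n, n - j⟩ X ^ j`. -/
noncomputable def eulerianPoly (n : ℕ) : Polynomial ℂ :=
  ∑ j ∈ range (n + 1), Polynomial.C (eulerianNum n (n - j) : ℂ) * Polynomial.X ^ j

theorem eval_eulerianPoly (n : ℕ) (c : ℂ) :
    (eulerianPoly n).eval c = ∑ j ∈ range (n + 1), (eulerianNum n (n - j) : ℂ) * c ^ j := by
  simp [eulerianPoly, Polynomial.eval_finsetSum]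

open PowerSeries in
theorem coeff_one_sub_X_pow (n k : ℕ) :
    coeff k ((1 - X : ℂ⟦X⟧) ^ n) = (-1) ^ k * (n.choose k : ℂ) := by
  have : (1 - X : ℂ⟦X⟧) ^ n = rescale (-1) ((1 + X) ^ n) := by
    simp [map_pow, rescale_X, sub_eq_add_neg]
  rw [this, coeff_rescale]
  congr 1
  have : ((1 + X : ℂ⟦X⟧) ^ n) = (((1 + Polynomial.X) ^ n : Polynomial ℂ) : ℂ⟦X⟧) := by simp
  rw [this, Polynomial.coeff_coe, Polynomial.coeff_one_add_X_pow]

open PowerSeries in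
/-- `∑ m ^ n X ^ m = eulerianPoly n / (1 - X) ^ (n + 1)` as formal power series. -/
theorem coe_eulerianPoly (n : ℕ) :
    (eulerianPoly n : ℂ⟦X⟧) = (1 - X) ^ (n + 1) * PowerSeries.mk fun m => (m : ℂ) ^ n := by
  ext j
  have hsum : coeff j ((1 - X : ℂ⟦X⟧) ^ (n + 1) * PowerSeries.mk fun m => (m : ℂ) ^ n) =
      ((∑ k ∈ range (j + 1), (-1 : ℤ) ^ k * ((n + 1).choose k : ℤ) * ((j : ℤ) - k) ^ n : ℤ) : ℂ) := by
    rw [coeff_mul, Finset.Nat.sum_antidiagonal_eq_sum_range_succ_mk]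
    push_cast
    refine sum_congr rfl fun k hk => ?_
    rw [coeff_one_sub_X_pow, coeff_mk, Nat.cast_sub (by simpa [Nat.lt_succ_iff] using hk)]
  rw [hsum, Polynomial.coeff_coe]
  have hl : (eulerianPoly n).coeff j =
      if j ≤ n then (eulerianNum n (n - j) : ℂ) else 0 := by
    simp [eulerianPoly, Polynomial.finsetSum_coeff, Polynomial.coeff_X_pow]
  rw [hl]
  split_ifs with hj
  · rw [eulerianNum_sub_eq_sum hj]
  · rw [← Int.cast_zero, ← sum_neg_one_pow_mul_choose_mul_sub_pow n j]
    congr 1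
    refine sum_subset (range_subset_range.2 (by omega)) fun k _ hk => ?_
    rw [Nat.choose_eq_zero_of_lt (by simp at hk; omega)]
    simp

open PowerSeries in
theorem X_mul_sum_choose_mul_eulerianPoly {n : ℕ} (hn : n ≠ 0) :
    Polynomial.X * ∑ k ∈ range (n + 1), (n.choose k : Polynomial ℂ) *
      (1 - Polynomial.X) ^ (n - k) * eulerianPoly k = eulerianPoly n := by
  apply Polynomial.coe_injective ℂ
  have key : (X : ℂ⟦X⟧) * ∑ k ∈ range (n + 1), (n.choose k : ℂ⟦X⟧) *
      (PowerSeries.mk fun m => (m : ℂ) ^ k) = PowerSeries.mk fun m => (m : ℂ) ^ n := by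
    ext m
    cases m with
    | zero => simp [hn]
    | succ m =>
      rw [coeff_succ_X_mul, map_sum, coeff_mk]
      push_cast
      rw [add_pow]
      refine sum_congr rfl fun k _ => ?_
      rw [← nsmul_eq_mul, map_nsmul, coeff_mk]
      simp [mul_comm]
  have hcast : ((Polynomial.X * ∑ k ∈ range (n + 1), (n.choose k : Polynomial ℂ) *
      (1 - Polynomial.X) ^ (n - k) * eulerianPoly k : Polynomial ℂ) : ℂ⟦X⟧) =
      X * ∑ k ∈ range (n + 1), (n.choose k : ℂ⟦X⟧) * (1 - X) ^ (n - k) *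
        (eulerianPoly k : ℂ⟦X⟧) := by
    simp only [← Polynomial.coeToPowerSeries.ringHom_apply, map_mul, map_sum, map_pow, map_sub,
      map_one, map_natCast]
    simp
  rw [hcast, coe_eulerianPoly, ← key, mul_left_comm]
  congr 1
  rw [mul_sum]
  refine sum_congr rfl fun k hk => ?_
  rw [coe_eulerianPoly, show n + 1 = (n - k) + (k + 1) by simp at hk; omega, pow_add]
  ring

/-- `∑ eulerianPoly n (c) / (1 - c) ^ (n + 1) * t ^ n / n!`, the expansion of `1 / (1 - c e ^ t)`. -/
noncomputable def eulerianSeries (c : ℂ) : PowerSeries ℂ :=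
  PowerSeries.mk fun n => (eulerianPoly n).eval c / (1 - c) ^ (n + 1) / n.factorial

open PowerSeries in
theorem eulerianSeries_mul {c : ℂ} (hc : c ≠ 1) :
    eulerianSeries c * (1 - C c * exp ℂ) = 1 := by
  have hc' : 1 - c ≠ 0 := sub_ne_zero.2 hc.symm
  ext n
  have hprod : coeff n (eulerianSeries c * exp ℂ) = (∑ k ∈ range (n + 1), (n.choose k : ℂ) *
      (1 - c) ^ (n - k) * (eulerianPoly k).eval c) / (1 - c) ^ (n + 1) / n.factorial := by
    rw [coeff_mul, Finset.Nat.sum_antidiagonal_eq_sum_range_succ_mk, sum_div, sum_div]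
    refine sum_congr rfl fun k hk => ?_
    have hk' : k ≤ n := by simpa [Nat.lt_succ_iff] using hk
    simp only [eulerianSeries, coeff_mk, coeff_exp, Nat.cast_choose ℂ hk']
    have hpow : (1 - c) ^ (n + 1) = (1 - c) ^ (n - k) * (1 - c) ^ (k + 1) := by
      rw [← pow_add]; congr 1; omega
    rw [hpow]
    have h1 : (n.factorial : ℂ) ≠ 0 := by exact_mod_cast n.factorial_ne_zero
    have h2 : (k.factorial : ℂ) ≠ 0 := by exact_mod_cast k.factorial_ne_zero
    have h3 : ((n - k).factorial : ℂ) ≠ 0 := by exact_mod_cast (n - k).factorial_ne_zero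
    simp only [map_div₀, map_one, map_natCast]
    field_simp
  rw [show eulerianSeries c * (1 - C c * exp ℂ) =
    eulerianSeries c - C c * (eulerianSeries c * exp ℂ) by ring, map_sub, coeff_C_mul, hprod]
  rcases eq_or_ne n 0 with rfl | hn
  · simp [eulerianSeries, eulerianPoly, eulerianNum]
    field_simp
  · have h := congrArg (Polynomial.eval c) (X_mul_sum_choose_mul_eulerianPoly hn)
    simp only [Polynomial.eval_mul, Polynomial.eval_finsetSum, Polynomial.eval_pow,
      Polynomial.eval_sub, Polynomial.eval_one, Polynomial.eval_X, Polynomial.eval_natCast] at h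
    rw [← mul_div_assoc, ← mul_div_assoc, h]
    simp [eulerianSeries, coeff_one, hn]

/-- Powers expand into falling factorials with Stirling coefficients. -/
theorem sum_stirling2_mul_descFactorial (n m : ℕ) :
    ∑ i ∈ range (n + 1), stirling2 n i * (m.descFactorial i : ℂ) = (m : ℂ) ^ n := by
  have hS : ∀ i, stirling2 n i * (m.descFactorial i : ℂ) =
      m.choose i • (fwdDiff (1 : ℂ))^[i] (fun x => x ^ n) 0 := by
    intro i
    have hi : (i.factorial : ℂ) ≠ 0 := by exact_mod_cast i.factorial_ne_zero
    rw [fwdDiff_iter_eq_sum_shift, ← sum_flip, stirling2, Nat.descFactorial_eq_factorial_mul_choose,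
      nsmul_eq_mul]
    push_cast
    have : ∀ k ∈ range (i + 1), ((-1 : ℤ) ^ (i - (i - k)) * (i.choose (i - k) : ℤ)) •
        ((0 : ℂ) + (i - k) • 1) ^ n = (-1 : ℂ) ^ k * (i.choose k : ℂ) * ((i - k : ℕ) : ℂ) ^ n := by
      intro k hk
      have hk' : k ≤ i := by simpa [Nat.lt_succ_iff] using hk
      rw [Nat.sub_sub_self hk', Nat.choose_symm hk']
      simp
    rw [sum_congr rfl this]
    field_simp
  have h := shift_eq_sum_fwdDiff_iter (1 : ℂ) (fun x : ℂ => x ^ n) m 0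
  simp only [zero_add, nsmul_eq_mul, mul_one] at h
  rw [h, sum_congr rfl fun i _ => hS i]
  simp only [nsmul_eq_mul]
  rw [sum_subset (range_subset_range.2 (Nat.succ_le_succ (le_max_left n m))),
    sum_subset (range_subset_range.2 (Nat.succ_le_succ (le_max_right n m)))]
  · intro i _ hi
    rw [Nat.choose_eq_zero_of_lt (by simp at hi; omega)]
    simp
  · intro i _ hi
    rw [fwdDiff_iter_pow_eq_zero_of_lt (by simp at hi; omega)]
    simp

theorem sum_stirling2_mul_iteratedDeriv {ι : Type*} (s : Finset ι) (w : ι → ℕ) (n : ℕ) (z : ℂ) :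
    ∑ i ∈ range (n + 1), stirling2 n i * z ^ i *
      iteratedDeriv i (fun x : ℂ => ∑ j ∈ s, x ^ w j) z = ∑ j ∈ s, z ^ w j * (w j : ℂ) ^ n := by
  have h : ∀ i, iteratedDeriv i (fun x : ℂ => ∑ j ∈ s, x ^ w j) z =
      ∑ j ∈ s, ((w j).descFactorial i : ℂ) * z ^ (w j - i) := by
    intro i
    rw [iteratedDeriv_fun_sum fun j _ => by fun_prop]
    simp only [iteratedDeriv_pow]
  simp only [h, mul_sum]
  rw [sum_comm]
  refine sum_congr rfl fun j _ => ?_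
  rw [← sum_stirling2_mul_descFactorial, mul_sum]
  refine sum_congr rfl fun i _ => ?_
  rcases le_or_gt i (w j) with hi | hi
  · rw [← pow_sub_mul_pow z hi]; ring
  · simp [Nat.descFactorial_of_lt hi]

theorem representable_arith_iff {a d k : ℕ} (hk : 2 ≤ k) (n : ℕ) :
    Representable (fun j : Fin k => a + (j : ℕ) * d) n ↔
      ∃ N M, M ≤ N * (k - 1) ∧ n = N * a + M * d := by
  constructor
  · rintro ⟨x, rfl⟩
    refine ⟨∑ j, x j, ∑ j, x j * j, ?_, ?_⟩
    · rw [sum_mul]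
      exact sum_le_sum fun j _ => Nat.mul_le_mul_left _ (by omega)
    · rw [sum_mul, sum_mul, ← sum_add_distrib]
      exact sum_congr rfl fun j _ => by ring
  · rintro ⟨N, M, hM, rfl⟩
    induction N generalizing M with
    | zero =>
      obtain rfl : M = 0 := by simpa using hM
      exact ⟨0, by simp⟩
    | succ N ih =>
      obtain ⟨x, hx⟩ := ih (M - min M (k - 1)) (by rw [Nat.succ_mul] at hM; omega)
      refine ⟨x + Pi.single ⟨min M (k - 1), by omega⟩ 1, ?_⟩
      simp only [Pi.add_apply, add_mul, sum_add_distrib]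
      simp only [← hx, Pi.single_apply, ite_mul, one_mul, zero_mul, sum_ite_eq',
        mem_univ, if_true]
      have : M * d = (M - min M (k - 1)) * d + min M (k - 1) * d := by
        rw [← add_mul, Nat.sub_add_cancel (min_le_left _ _)]
      omega

/-- The least element congruent to `i * d` modulo `a` of the semigroup generated by
`a, a + d, …, a + m * d`. -/
def aperyElt (a d m i : ℕ) : ℕ := (i + m - 1) / m * a + i * d

theorem aperyElt_mod (a d m i : ℕ) : aperyElt a d m i % a = i * d % a :=
  Nat.mul_add_mod_self_right _ _ _

theorem representable_arith_iff_exists_aperyElt {a d k : ℕ} (ha : 0 < a) (hk : 2 ≤ k) (n : ℕ) :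
    Representable (fun j : Fin k => a + (j : ℕ) * d) n ↔
      ∃ i < a, ∃ l, n = aperyElt a d (k - 1) i + l * a := by
  rw [representable_arith_iff hk]
  have hk' : 0 < k - 1 := by omega
  constructor
  · rintro ⟨N, M, hM, rfl⟩
    have hc : (M % a + (k - 1) - 1) / (k - 1) ≤ N := by
      have h1 : M % a ≤ N * (k - 1) := (Nat.mod_le _ _).trans hM
      refine Nat.le_of_lt_succ ((Nat.div_lt_iff_lt_mul hk').2 ?_)
      rw [Nat.succ_mul]; omega
    refine ⟨M % a, Nat.mod_lt _ ha, N - (M % a + (k - 1) - 1) / (k - 1) + M / a * d, ?_⟩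
    obtain ⟨e, he⟩ := Nat.exists_eq_add_of_le hc
    have hM' : M * d = M % a * d + M / a * d * a := by
      conv_lhs => rw [← Nat.mod_add_div M a]
      ring
    rw [aperyElt, hM', show N - (M % a + (k - 1) - 1) / (k - 1) = e by omega]
    nth_rw 1 [he]
    ring
  · rintro ⟨i, -, l, rfl⟩
    refine ⟨(i + (k - 1) - 1) / (k - 1) + l, i, ?_, by rw [aperyElt]; ring⟩
    have h1 := Nat.lt_div_mul_add (a := i + (k - 1) - 1) hk'
    rw [add_mul]
    omega

theorem injOn_mul_mod {a d : ℕ} (hgcd : a.Coprime d) :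
    Set.InjOn (fun i => i * d % a) (range a : Finset ℕ) := by
  intro i hi j hj h
  have h' : i ≡ j [MOD a] := Nat.ModEq.cancel_right_of_coprime hgcd h
  simp only [coe_range, Set.mem_Iio] at hi hj
  exact Nat.ModEq.eq_of_lt_of_lt h' hi hj

theorem image_mul_mod {a d : ℕ} (ha : 0 < a) (hgcd : a.Coprime d) :
    (range a).image (fun i => i * d % a) = range a := by
  refine eq_of_subset_of_card_le (fun x hx => ?_) (card_image_of_injOn (injOn_mul_mod hgcd)).ge
  obtain ⟨i, -, rfl⟩ := mem_image.1 hx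
  exact mem_range.2 (Nat.mod_lt _ ha)

theorem finsum_mem_NRset {a d k : ℕ} (ha : 0 < a) (hk : 2 ≤ k) (hgcd : a.Coprime d)
    {R : Type*} [AddCommMonoid R] (f : ℕ → R) :
    ∑ᶠ n ∈ NRset (fun j : Fin k => a + (j : ℕ) * d), f n =
      ∑ i ∈ range a, ∑ l ∈ range (aperyElt a d (k - 1) i / a), f (i * d % a + a * l) := by
  set e : (Σ _ : ℕ, ℕ) → ℕ := fun p => p.1 * d % a + a * p.2 with he
  set S := (range a).sigma fun i => range (aperyElt a d (k - 1) i / a) with hS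
  have hmod : ∀ p, e p % a = p.1 * d % a := fun p => by simp [he]
  have hdiv : ∀ p, e p / a = p.2 := fun p => by
    simp [he, Nat.add_mul_div_left _ _ ha, Nat.div_eq_of_lt (Nat.mod_lt _ ha)]
  have hinj : Set.InjOn e S := by
    rintro ⟨i, l⟩ hi ⟨j, m⟩ hj h
    simp only [hS, coe_sigma, Set.mem_sigma_iff, coe_range] at hi hj
    have h1 := congrArg (· % a) h
    have h2 := congrArg (· / a) h
    simp only [hmod, hdiv] at h1 h2
    obtain rfl : i = j := injOn_mul_mod hgcd (by simpa using hi.1) (by simpa using hj.1) h1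
    rw [h2]
  have himg : NRset (fun j : Fin k => a + (j : ℕ) * d) = e '' S := by
    ext n
    simp only [NRset, Set.mem_ofPred_eq, representable_arith_iff_exists_aperyElt ha hk,
      Set.mem_image]
    constructor
    · rintro ⟨-, hn⟩
      obtain ⟨i, hi, hin⟩ := mem_image.1
        ((image_mul_mod ha hgcd).symm ▸ mem_range.2 (Nat.mod_lt n ha) :
          n % a ∈ (range a).image (fun i => i * d % a))
      refine ⟨⟨i, n / a⟩, ?_, by simp only [he, hin]; exact Nat.mod_add_div n a⟩
      simp only [hS, coe_sigma, Set.mem_sigma_iff, coe_range, Set.mem_Iio]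
      refine ⟨mem_range.1 hi, not_le.1 fun hle => hn ⟨i, mem_range.1 hi,
        n / a - aperyElt a d (k - 1) i / a, ?_⟩⟩
      obtain ⟨c, hc⟩ := Nat.exists_eq_add_of_le hle
      have h1 := Nat.mod_add_div n a
      have h2 := Nat.mod_add_div (aperyElt a d (k - 1) i) a
      rw [aperyElt_mod, hin] at h2
      rw [show n / a - aperyElt a d (k - 1) i / a = c by omega, ← h1, hc]
      nth_rw 2 [← h2]
      ring
    · rintro ⟨⟨i, l⟩, hp, rfl⟩
      simp only [hS, coe_sigma, Set.mem_sigma_iff, coe_range, Set.mem_Iio] at hp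
      have hnot : ¬ ∃ j < a, ∃ m, e ⟨i, l⟩ = aperyElt a d (k - 1) j + m * a := by
        rintro ⟨j, hj, m, h⟩
        have h1 := congrArg (· % a) h
        have h2 := congrArg (· / a) h
        simp only [hmod, hdiv, Nat.add_mul_mod_self_right, aperyElt_mod,
          Nat.add_mul_div_right _ _ ha] at h1 h2
        obtain rfl : i = j := injOn_mul_mod hgcd (by simpa using hp.1) (by simpa using hj) h1
        omega
      refine ⟨Nat.pos_of_ne_zero fun h0 => hnot ⟨0, ha, 0, ?_⟩, hnot⟩
      rw [h0, aperyElt, Nat.div_eq_of_lt (by omega)]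
      simp
  rw [himg, finsum_mem_image hinj, finsum_mem_coe_finset, sum_sigma]

theorem sum_pow_gaps_mul_one_sub_pow {R : Type*} [CommRing R] (x : R) {a d : ℕ} (ha : 0 < a)
    (hgcd : a.Coprime d) (m : ℕ) :
    (∑ i ∈ range a, ∑ l ∈ range (aperyElt a d m i / a), x ^ (i * d % a + a * l)) * (1 - x ^ a) =
      ∑ i ∈ range a, x ^ i - ∑ i ∈ range a, x ^ aperyElt a d m i := by
  conv_rhs => rw [← image_mul_mod ha hgcd, sum_image (injOn_mul_mod hgcd), image_mul_mod ha hgcd]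
  rw [sum_mul, ← sum_sub_distrib]
  refine sum_congr rfl fun i _ => ?_
  have h := Nat.mod_add_div (aperyElt a d m i) a
  rw [aperyElt_mod] at h
  conv_rhs => rw [← h, pow_add, pow_mul]
  simp only [pow_add, pow_mul]
  rw [← mul_sum, mul_assoc, geom_sum_mul_neg]
  ring

theorem sum_range_mul_eq {R : Type*} [AddCommMonoid R] (f : ℕ → R) (q m : ℕ) :
    ∑ i ∈ range (q * m), f i = ∑ s ∈ range q, ∑ j ∈ range m, f (s * m + j) := by
  induction q with
  | zero => simp
  | succ q ih => rw [Nat.succ_mul, sum_range_add, ih, sum_range_succ]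

theorem sum_pow_aperyElt (x : ℂ) {a d m q r : ℕ} (ha : 0 < a) (hqr : a - 1 = q * m + r)
    (hr : r < m) :
    ∑ i ∈ range a, x ^ aperyElt a d m i = 1 +
        x ^ (a + d) * (∑ j ∈ range m, x ^ (j * d)) *
          (∑ s ∈ range q, x ^ (s * (a + m * d))) +
        x ^ (q * (a + m * d) + a + d) * (∑ t ∈ range r, x ^ (t * d)) := by
  have hm : 0 < m := by omega
  have hw : ∀ s j, j < m → aperyElt a d m (s * m + j + 1) = s * (a + m * d) + a + d + j * d := by
    intro s j hj
    have : (s * m + j + 1 + m - 1) / m = s + 1 := by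
      rw [show s * m + j + 1 + m - 1 = j + (s + 1) * m by rw [add_mul]; omega,
        Nat.add_mul_div_right _ _ hm, Nat.div_eq_of_lt hj, zero_add]
    rw [aperyElt, this]
    ring
  have h0 : aperyElt a d m 0 = 0 := by
    rw [aperyElt, Nat.div_eq_of_lt (by omega)]; simp
  rw [show a = q * m + r + 1 by omega, sum_range_succ', ← show a = q * m + r + 1 by omega,
    sum_range_add, sum_range_mul_eq, h0, pow_zero]
  have h1 : ∑ s ∈ range q, ∑ j ∈ range m, x ^ aperyElt a d m (s * m + j + 1) =
      x ^ (a + d) * (∑ j ∈ range m, x ^ (j * d)) * ∑ s ∈ range q, x ^ (s * (a + m * d)) := by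
    rw [mul_sum]
    refine sum_congr rfl fun s _ => ?_
    rw [mul_sum, sum_mul]
    refine sum_congr rfl fun j hj => ?_
    rw [hw s j (mem_range.1 hj)]
    ring
  have h2 : ∑ t ∈ range r, x ^ aperyElt a d m (q * m + t + 1) =
      x ^ (q * (a + m * d) + a + d) * ∑ t ∈ range r, x ^ (t * d) := by
    rw [mul_sum]
    refine sum_congr rfl fun t ht => ?_
    rw [hw q t ((mem_range.1 ht).trans hr), pow_add]
  rw [h1, h2]
  ring

open PowerSeries in
theorem coeff_C_mul_exp_pow (c : ℂ) (n μ : ℕ) :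
    coeff μ ((C c * exp ℂ) ^ n) = c ^ n * (n : ℂ) ^ μ / μ.factorial := by
  rw [mul_pow, exp_pow_eq_rescale_exp, ← map_pow, coeff_C_mul, coeff_rescale, coeff_exp]
  simp only [map_div₀, map_one, map_natCast]
  ring

open PowerSeries in
theorem rescale_eulerianSeries_mul {c : ℂ} {a : ℕ} (hc : c ^ a ≠ 1) :
    rescale (a : ℂ) (eulerianSeries (c ^ a)) * (1 - (C c * exp ℂ) ^ a) = 1 := by
  have h := congrArg (rescale (a : ℂ)) (eulerianSeries_mul hc)
  have hC : rescale (a : ℂ) (C (c ^ a)) = C (c ^ a) := by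
    ext n; rw [coeff_rescale, coeff_C]; split_ifs with hn <;> simp [hn]
  rwa [map_mul, map_sub, map_one, map_mul, hC, ← exp_pow_eq_rescale_exp, map_pow, ← mul_pow] at h

/-- Weighted Sylvester power sum for an arithmetic sequence, `λ^a ≠ 1`, `λ^d ≠ 1`. -/
theorem stmt13 (a d k q r : ℕ) (ha : 0 < a) (hd : 0 < d)
    (hk : 2 ≤ k) (hka : k ≤ a) (hgcd : Nat.gcd a d = 1)
    (hqr : a - 1 = q * (k - 1) + r) (hr : r < k - 1)
    (P : ℂ → ℂ)
    (hP : P = fun x => 1 +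
        x ^ (a + d) * (∑ j ∈ Finset.range (k - 1), x ^ (j * d)) *
          (∑ s ∈ Finset.range q, x ^ (s * (a + (k - 1) * d))) +
        x ^ (q * (a + (k - 1) * d) + a + d) * (∑ t ∈ Finset.range r, x ^ (t * d)))
    (lam : ℂ) (hl0 : lam ≠ 0) (hla : lam ^ a ≠ 1) (hld : lam ^ d ≠ 1)
    (μ : ℕ) (hμ : 0 < μ) :
    ∑ᶠ n ∈ NRset (fun j : Fin k => a + (j : ℕ) * d), lam ^ n * (n : ℂ) ^ μ =
      ∑ n ∈ Finset.range (μ + 1),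
          ((-(a : ℂ)) ^ n / (lam ^ a - 1) ^ (n + 1)) * (μ.choose n : ℂ) *
            (∑ j ∈ Finset.range (n + 1), (eulerianNum n (n - j) : ℂ) * lam ^ (j * a)) *
            (∑ i ∈ Finset.range (μ - n + 1), stirling2 (μ - n) i * lam ^ i * iteratedDeriv i P lam)
        + ((-1 : ℂ) ^ (μ + 1) / (lam - 1) ^ (μ + 1)) *
            ∑ j ∈ Finset.range (μ + 1), (eulerianNum μ (μ - j) : ℂ) * lam ^ j := by
  have hl1 : lam ≠ 1 := fun h => hla (by rw [h, one_pow])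
  obtain rfl : P = fun x => ∑ i ∈ range a, x ^ aperyElt a d (k - 1) i := by
    rw [hP]; funext x; exact (sum_pow_aperyElt x ha hqr hr).symm
  rw [finsum_mem_NRset ha hk hgcd]
  simp only [sum_stirling2_mul_iteratedDeriv, pow_mul']
  have hfac : ∀ n : ℕ, (n.factorial : ℂ) ≠ 0 := fun n => by exact_mod_cast n.factorial_ne_zero
  set x := PowerSeries.C lam * PowerSeries.exp ℂ with hx
  set U := PowerSeries.rescale (a : ℂ) (eulerianSeries (lam ^ a)) with hU
  have hUa : U * (1 - x ^ a) = 1 := rescale_eulerianSeries_mul hla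
  have hU1 : eulerianSeries lam * (1 - x) = 1 := eulerianSeries_mul hl1
  have hgap := sum_pow_gaps_mul_one_sub_pow x ha hgcd (k - 1)
  have hgeom := geom_sum_mul_neg x a
  have hseries : ∑ i ∈ range a, ∑ l ∈ range (aperyElt a d (k - 1) i / a), x ^ (i * d % a + a * l) =
      eulerianSeries lam - U * ∑ i ∈ range a, x ^ aperyElt a d (k - 1) i := by
    linear_combination U * hgap -
      (∑ i ∈ range a, ∑ l ∈ range (aperyElt a d (k - 1) i / a), x ^ (i * d % a + a * l)) * hUa
      + U * eulerianSeries lam * hgeom - U * (∑ i ∈ range a, x ^ i) * hU1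
      + eulerianSeries lam * hUa
  have hcoeff := congrArg (fun f => (μ.factorial : ℂ) * PowerSeries.coeff μ f) hseries
  simp only [map_sum, map_sub, PowerSeries.coeff_mul, hx, coeff_C_mul_exp_pow, mul_sum, mul_sub,
    Finset.Nat.sum_antidiagonal_eq_sum_range_succ_mk] at hcoeff
  rw [sum_congr rfl fun i _ => sum_congr rfl fun l _ => mul_div_cancel₀ _ (hfac μ)] at hcoeff
  rw [hcoeff, sub_eq_neg_add, sum_comm, ← sum_neg_distrib]
  congr 1
  · refine sum_congr rfl fun n hn => ?_
    have hn' : n ≤ μ := by simpa [Nat.lt_succ_iff] using hn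
    rw [← eval_eulerianPoly, hU, PowerSeries.coeff_rescale, eulerianSeries, PowerSeries.coeff_mk,
      Nat.cast_choose ℂ hn', mul_sum, ← sum_neg_distrib]
    refine sum_congr rfl fun i _ => ?_
    have hl : 1 - lam ^ a ≠ 0 := sub_ne_zero.2 hla.symm
    have h1 := hfac n
    have h2 := hfac (μ - n)
    have h3 : (lam ^ a - 1) ^ (n + 1) = -((-1) ^ n * (1 - lam ^ a) ^ (n + 1)) := by
      rw [← neg_sub, neg_pow]; ring
    have h4 : (-1 : ℂ) ^ n ≠ 0 := by simp
    rw [h3, neg_pow (a : ℂ)]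
    field_simp
  · rw [← eval_eulerianPoly, eulerianSeries, PowerSeries.coeff_mk]
    have hl : 1 - lam ≠ 0 := sub_ne_zero.2 hl1.symm
    have h1 := hfac μ
    have h3 : (lam - 1) ^ (μ + 1) = (-1) ^ (μ + 1) * (1 - lam) ^ (μ + 1) := by
      rw [← neg_sub, neg_pow]
    have h4 : (-1 : ℂ) ^ (μ + 1) ≠ 0 := by simp
    rw [h3]
    field_simp
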